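/- arXiv:0810.1577 — 3 statements merged into one kernel-verified Lean document; each statement's English description precedes it below -/
import Mathlib

section
/- Under Assumption A, suppose (x₀,ξ₀) ∈ ℝ^{2n} is forward nontrapping with respect to k. Then there exist δ > 0, an open neighborhood Ω of (x₀,ξ₀), λ₀ > 0 and constants c₁, c₂ > 0 such that for all λ ≥ λ₀, all (x,ξ) ∈ Ω and all t with 0 ≤ t ≤ λδ, the position component of the Hamilton flow of p^λ satisfies |y^λ(t;x,ξ)| ≥ c₁ t − c₂. -/
open Real Filter
open scoped BigOperators Topology

noncomputable section

/-- Euclidean configuration space `ℝⁿ`. -/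
abbrev En (n : ℕ) := EuclideanSpace ℝ (Fin n)

/-- Partial derivative `∂f/∂x_j` of a function on `ℝⁿ`. -/
noncomputable def pd {n : ℕ} (f : En n → ℝ) (j : Fin n) (x : En n) : ℝ :=
  fderiv ℝ f x (EuclideanSpace.single j 1)

/-- Japanese bracket `⟨x⟩ = (1+|x|²)^{1/2}` on `ℝⁿ`. -/
noncomputable def jb {n : ℕ} (x : En n) : ℝ := Real.sqrt (1 + ‖x‖ ^ 2)

/-- Japanese bracket `⟨t⟩` on `ℝ`. -/
noncomputable def jbR (t : ℝ) : ℝ := Real.sqrt (1 + t ^ 2)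

/-- Kronecker delta. -/
def kdelta {n : ℕ} (j k : Fin n) : ℝ := if j = k then 1 else 0

/-- Assumption A: smooth symmetric positive-definite coefficients `a_{jk}` which are a
short-range perturbation of `δ_{jk}`, and a potential `V = O(⟨x⟩^{2-μ})`, with symbol-type
bounds on all derivatives. -/
structure AssumptionA (n : ℕ) (a : Fin n → Fin n → En n → ℝ) (V : En n → ℝ) (μ : ℝ) : Prop where
  n_pos : 0 < n
  one_lt_mu : 1 < μ
  smooth_a : ∀ j k, ContDiff ℝ (⊤ : ℕ∞) (a j k)
  smooth_V : ContDiff ℝ (⊤ : ℕ∞) V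
  symm : ∀ j k x, a j k x = a k j x
  posdef : ∀ x (ξ : En n), ξ ≠ 0 → 0 < ∑ j, ∑ k, a j k x * ξ j * ξ k
  decay_a : ∀ (m : ℕ) (j k : Fin n), ∃ C > 0, ∀ x,
      ‖iteratedFDeriv ℝ m (fun y => a j k y - kdelta j k) x‖ ≤ C * jb x ^ (-μ - (m : ℝ))
  decay_V : ∀ (m : ℕ), ∃ C > 0, ∀ x,
      ‖iteratedFDeriv ℝ m V x‖ ≤ C * jb x ^ (2 - μ - (m : ℝ))

/-- Kinetic energy symbol `k(x,ξ) = ½ Σ a_{jk}(x) ξ_j ξ_k`. -/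
noncomputable def ksym {n : ℕ} (a : Fin n → Fin n → En n → ℝ) (x ξ : En n) : ℝ :=
  (1 / 2) * ∑ j, ∑ k, a j k x * ξ j * ξ k

/-- Full symbol `p(x,ξ) = k(x,ξ) + ½|x|² + V(x)`. -/
noncomputable def psym {n : ℕ} (a : Fin n → Fin n → En n → ℝ) (V : En n → ℝ) (x ξ : En n) : ℝ :=
  ksym a x ξ + ‖x‖ ^ 2 / 2 + V x

/-- Scaled symbol `p^λ(x,ξ) = k(x,ξ) + |x|²/(2λ²) + V(x)/λ²`. -/
noncomputable def plam {n : ℕ} (a : Fin n → Fin n → En n → ℝ) (V : En n → ℝ) (lam : ℝ)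
    (x ξ : En n) : ℝ :=
  ksym a x ξ + ‖x‖ ^ 2 / (2 * lam ^ 2) + V x / lam ^ 2

/-- `(y,η)` is a (global) solution of the Hamilton equations of `k(x,ξ)=½Σa_{jk}(x)ξ_jξ_k`. -/
def IsFlowK {n : ℕ} (a : Fin n → Fin n → En n → ℝ) (y η : ℝ → En n) : Prop :=
  (∀ t (j : Fin n), HasDerivAt (fun s => y s j) (∑ i, a j i (y t) * η t i) t) ∧
  (∀ t (j : Fin n), HasDerivAt (fun s => η s j)
      (-((1 / 2) * ∑ i, ∑ l, pd (a i l) j (y t) * η t i * η t l)) t)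

/-- `(y,η)` is a (global) solution of the Hamilton equations of `p(x,ξ)`. -/
def IsFlowP {n : ℕ} (a : Fin n → Fin n → En n → ℝ) (V : En n → ℝ) (y η : ℝ → En n) : Prop :=
  (∀ t (j : Fin n), HasDerivAt (fun s => y s j) (∑ i, a j i (y t) * η t i) t) ∧
  (∀ t (j : Fin n), HasDerivAt (fun s => η s j)
      (-((1 / 2) * ∑ i, ∑ l, pd (a i l) j (y t) * η t i * η t l + y t j + pd V j (y t))) t)

/-- `(y,η)` is a (global) solution of the Hamilton equations of `p^λ(x,ξ)`. -/
def IsFlowPlam {n : ℕ} (a : Fin n → Fin n → En n → ℝ) (V : En n → ℝ) (lam : ℝ)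
    (y η : ℝ → En n) : Prop :=
  (∀ t (j : Fin n), HasDerivAt (fun s => y s j) (∑ i, a j i (y t) * η t i) t) ∧
  (∀ t (j : Fin n), HasDerivAt (fun s => η s j)
      (-((1 / 2) * ∑ i, ∑ l, pd (a i l) j (y t) * η t i * η t l
          + y t j / lam ^ 2 + pd V j (y t) / lam ^ 2)) t)

/-- First (position) component of `exp(-tH_{p₀^λ})` applied to `(y t, η t)`:
`z^λ(t) = cos(t/λ) y^λ(t) − λ sin(t/λ) η^λ(t)`. -/
noncomputable def zlam {n : ℕ} (lam : ℝ) (y η : ℝ → En n) (t : ℝ) : En n :=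
  Real.cos (t / lam) • y t - (lam * Real.sin (t / lam)) • η t

/-- Second (momentum) component: `ζ^λ(t) = λ⁻¹ sin(t/λ) y^λ(t) + cos(t/λ) η^λ(t)`. -/
noncomputable def zetalam {n : ℕ} (lam : ℝ) (y η : ℝ → En n) (t : ℝ) : En n :=
  (lam⁻¹ * Real.sin (t / lam)) • y t + Real.cos (t / lam) • η t

end

/-- Abstract form of Assumption A: a symmetric positive matrix field `A` tending to the identity
and a potential `V` of at most linear growth with bounded gradient. -/
structure HamiltonianBounds {n : ℕ} (A : En n → En n →L[ℝ] En n) (V : En n → ℝ) (C : ℝ) :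
    Prop where
  one_le : 1 ≤ C
  contDiff_A : ContDiff ℝ 2 A
  contDiff_V : ContDiff ℝ 2 V
  symm : ∀ x u v, inner ℝ (A x u) v = inner ℝ u (A x v)
  pos : ∀ x ξ, ξ ≠ 0 → 0 < inner ℝ (A x ξ) ξ
  norm_A_le : ∀ x, ‖A x‖ ≤ C
  norm_sub_one_le : ∀ x, ‖x‖ * ‖A x - 1‖ ≤ C
  norm_fderiv_A_le : ∀ x, ‖x‖ ^ 2 * ‖fderiv ℝ A x‖ ≤ C
  abs_V_le : ∀ x, |V x| ≤ C * (1 + ‖x‖)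
  norm_fderiv_V_le : ∀ x, ‖fderiv ℝ V x‖ ≤ C

/-- The energy `½⟨A(x)ξ,ξ⟩ + s(|x|²/2 + V(x))`; here `s` stands for `λ⁻²`. -/
noncomputable def energy {n : ℕ} (A : En n → En n →L[ℝ] En n) (V : En n → ℝ) (s : ℝ)
    (x ξ : En n) : ℝ :=
  inner ℝ (A x ξ) ξ / 2 + s * (‖x‖ ^ 2 / 2 + V x)

/-- The gradient in `x` of `½⟨A(x)ξ,ξ⟩`. -/
noncomputable def kineticGradient {n : ℕ} (A : En n → En n →L[ℝ] En n) (x ξ : En n) : En n :=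
  (InnerProductSpace.toDual ℝ (En n)).symm
    ((1 / 2 : ℝ) • (innerSL ℝ ξ).comp ((fderiv ℝ A x).flip ξ))

/-- The gradient in `x` of `|x|²/2 + V(x)`. -/
noncomputable def potentialGradient {n : ℕ} (V : En n → ℝ) (x : En n) : En n :=
  x + (InnerProductSpace.toDual ℝ (En n)).symm (fderiv ℝ V x)

/-- Global solutions of the Hamilton equations of `energy A V s`. -/
structure IsTrajectory {n : ℕ} (A : En n → En n →L[ℝ] En n) (V : En n → ℝ) (s : ℝ)
    (y η : ℝ → En n) : Prop where
  position : ∀ t, HasDerivAt y (A (y t) (η t)) t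
  momentum : ∀ t, HasDerivAt η (-(kineticGradient A (y t) (η t) + s • potentialGradient V (y t))) t

section Escape

variable {n : ℕ} {A : En n → En n →L[ℝ] En n} {V : En n → ℝ} {C s : ℝ} {y η : ℝ → En n}

theorem inner_kineticGradient (x ξ v : En n) :
    inner ℝ (kineticGradient A x ξ) v = inner ℝ ξ (fderiv ℝ A x v ξ) / 2 := by
  rw [kineticGradient, InnerProductSpace.toDual_symm_apply]
  simp
  ring

theorem inner_potentialGradient (x v : En n) :
    inner ℝ (potentialGradient V x) v = inner ℝ x v + fderiv ℝ V x v := by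
  rw [potentialGradient, inner_add_left, InnerProductSpace.toDual_symm_apply]

theorem contDiff_kineticGradient (hA : ContDiff ℝ 2 A) :
    ContDiff ℝ 1 fun z : En n × En n => kineticGradient A z.1 z.2 := by
  have h : ContDiff ℝ 1 (fderiv ℝ A) := hA.fderiv_right (by norm_num)
  unfold kineticGradient
  refine (InnerProductSpace.toDual ℝ (En n)).symm.toContinuousLinearEquiv.contDiff.comp ?_
  have hflip : ContDiff ℝ 1 fun z : En n × En n => (fderiv ℝ A z.1).flip :=
    (LinearIsometryEquiv.contDiff (𝕜 := ℝ) (E := En n →L[ℝ] En n →L[ℝ] En n)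
      (F := En n →L[ℝ] En n →L[ℝ] En n)
      (ContinuousLinearMap.flipₗᵢ ℝ (En n) (En n) (En n))).comp (h.comp contDiff_fst)
  have hinner : ContDiff ℝ 1 fun z : En n × En n => innerSL ℝ z.2 :=
    (ContinuousLinearMap.contDiff (E := En n) (F := StrongDual ℝ (En n)) (innerSL ℝ)).comp
      contDiff_snd
  have hcomp := hinner.clm_comp (hflip.clm_apply contDiff_snd)
  exact (contDiff_const (c := (1 / 2 : ℝ))).smul hcomp

theorem continuous_potentialGradient (hV : ContDiff ℝ 2 V) :
    Continuous (potentialGradient V) :=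
  continuous_id.add ((InnerProductSpace.toDual ℝ (En n)).symm.continuous.comp
    (hV.continuous_fderiv (by norm_num)))

theorem IsTrajectory.hasDerivAt_A (h : IsTrajectory A V s y η) (hA : ContDiff ℝ 2 A) (t : ℝ) :
    HasDerivAt (fun τ => A (y τ)) (fderiv ℝ A (y t) (A (y t) (η t))) t :=
  ((hA.differentiable (by norm_num)) (y t)).hasFDerivAt.comp_hasDerivAt t (h.position t)

theorem IsTrajectory.energy_eq (hB : HamiltonianBounds A V C) (h : IsTrajectory A V s y η)
    (t : ℝ) : energy A V s (y t) (η t) = energy A V s (y 0) (η 0) := by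
  have key : ∀ t, HasDerivAt (fun τ => energy A V s (y τ) (η τ)) 0 t := by
    intro t
    have h1 := ((((h.hasDerivAt_A hB.contDiff_A t).clm_apply (h.momentum t)).inner ℝ
      (h.momentum t)).div_const 2).add ((((h.position t).norm_sq.div_const 2).add
      (((hB.contDiff_V.differentiable (by norm_num)) (y t)).hasFDerivAt.comp_hasDerivAt t
        (h.position t))).const_mul s)
    refine (h1.congr_deriv ?_)
    have e : inner ℝ (kineticGradient A (y t) (η t) + s • potentialGradient V (y t))
        (A (y t) (η t)) = inner ℝ (η t) (fderiv ℝ A (y t) (A (y t) (η t)) (η t)) / 2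
          + s * (inner ℝ (y t) (A (y t) (η t)) + fderiv ℝ V (y t) (A (y t) (η t))) := by
      rw [inner_add_left, real_inner_smul_left, inner_kineticGradient, inner_potentialGradient]
    rw [inner_add_left, hB.symm _ (-_) (η t), inner_neg_left, inner_neg_right,
      real_inner_comm _ (A (y t) (η t)), e, real_inner_comm (η t)]
    ring
  exact is_const_of_deriv_eq_zero (fun t => (key t).differentiableAt) (fun t => (key t).deriv) t 0

theorem HamiltonianBounds.inner_nonneg (hB : HamiltonianBounds A V C) (x ξ : En n) :
    0 ≤ inner ℝ (A x ξ) ξ := by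
  by_cases h : ξ = 0
  · simp [h]
  · exact (hB.pos x ξ h).le

theorem HamiltonianBounds.norm_apply_sq_le (hB : HamiltonianBounds A V C) (x ξ : En n) :
    ‖A x ξ‖ ^ 2 ≤ C * inner ℝ (A x ξ) ξ := by
  have hC : 0 < C := by linarith [hB.one_le]
  have h0 := hB.inner_nonneg x (C • ξ - A x ξ)
  have h1 : inner ℝ (A x (A x ξ)) (A x ξ) ≤ C * ‖A x ξ‖ ^ 2 := by
    calc _ ≤ ‖A x (A x ξ)‖ * ‖A x ξ‖ := real_inner_le_norm _ _
      _ ≤ (C * ‖A x ξ‖) * ‖A x ξ‖ := by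
        gcongr
        exact (A x).le_of_opNorm_le (hB.norm_A_le x) _
      _ = _ := by ring
  have h2 : inner ℝ (A x (C • ξ - A x ξ)) (C • ξ - A x ξ) = C * (C * inner ℝ (A x ξ) ξ)
      - 2 * C * ‖A x ξ‖ ^ 2 + inner ℝ (A x (A x ξ)) (A x ξ) := by
    simp only [map_sub, map_smul, inner_sub_left, inner_sub_right, inner_smul_left,
      inner_smul_right, hB.symm x (A x ξ) ξ, real_inner_self_eq_norm_sq]
    simp
    ring
  rw [h2] at h0
  have : 0 ≤ C * (C * inner ℝ (A x ξ) ξ - ‖A x ξ‖ ^ 2) := by linarith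
  linarith [nonneg_of_mul_nonneg_right this hC]

theorem HamiltonianBounds.inner_le_energy (hB : HamiltonianBounds A V C) (hs : 0 ≤ s)
    (hs1 : s ≤ 1) (x ξ : En n) : inner ℝ (A x ξ) ξ ≤ 2 * (energy A V s x ξ + 2 * C ^ 2) := by
  have hC := hB.one_le
  have h1 := neg_le_of_abs_le (hB.abs_V_le x)
  have h2 : -(2 * C ^ 2) ≤ ‖x‖ ^ 2 / 2 + V x := by nlinarith [sq_nonneg (‖x‖ - C)]
  have h3 : -(2 * C ^ 2) ≤ s * (‖x‖ ^ 2 / 2 + V x) := by nlinarith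
  unfold energy
  linarith

theorem IsTrajectory.norm_velocity_le (hB : HamiltonianBounds A V C)
    (h : IsTrajectory A V s y η) (hs : 0 ≤ s) (hs1 : s ≤ 1) {e : ℝ}
    (he : energy A V s (y 0) (η 0) ≤ e) (t : ℝ) :
    ‖A (y t) (η t)‖ ≤ √(C * (2 * (e + 2 * C ^ 2))) := by
  apply Real.le_sqrt_of_sq_le
  refine (hB.norm_apply_sq_le _ _).trans ?_
  have hC := hB.one_le
  gcongr
  refine (hB.inner_le_energy hs hs1 _ _).trans ?_
  rw [h.energy_eq hB]
  gcongr

theorem IsTrajectory.norm_position_le (hB : HamiltonianBounds A V C)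
    (h : IsTrajectory A V s y η) (hs : 0 ≤ s) (hs1 : s ≤ 1) {e : ℝ}
    (he : energy A V s (y 0) (η 0) ≤ e) {t : ℝ} (ht : 0 ≤ t) :
    ‖y t‖ ≤ ‖y 0‖ + √(C * (2 * (e + 2 * C ^ 2))) * t := by
  have h1 := norm_image_sub_le_of_norm_deriv_le_segment' (f := y) (a := 0) (b := t)
    (fun τ _ => (h.position τ).hasDerivWithinAt)
    (fun τ _ => h.norm_velocity_le hB hs hs1 he τ) t ⟨ht, le_rfl⟩
  have h2 := norm_le_norm_add_norm_sub' (y t) (y 0)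
  rw [sub_zero] at h1
  linarith

theorem HamiltonianBounds.continuous_energy (hB : HamiltonianBounds A V C) :
    Continuous fun p : ℝ × En n × En n => energy A V p.1 p.2.1 p.2.2 := by
  have h1 := hB.contDiff_A.continuous
  have h2 := hB.contDiff_V.continuous
  unfold energy
  fun_prop

theorem HamiltonianBounds.exists_coercive (hB : HamiltonianBounds A V C) (R : ℝ) :
    ∃ c > 0, ∀ x ξ, ‖x‖ ≤ R → c * ‖ξ‖ ^ 2 ≤ inner ℝ (A x ξ) ξ := by
  have hc : IsCompact (Metric.closedBall (0 : En n) R ×ˢ Metric.sphere (0 : En n) 1) :=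
    (isCompact_closedBall _ _).prod (isCompact_sphere _ _)
  have hA := hB.contDiff_A.continuous
  have hcont : Continuous fun z : En n × En n => inner ℝ (A z.1 z.2) z.2 := by fun_prop
  obtain ⟨c, hc0, hc1⟩ : ∃ c > 0, ∀ z ∈ Metric.closedBall (0 : En n) R ×ˢ
      Metric.sphere (0 : En n) 1, c ≤ inner ℝ (A z.1 z.2) z.2 := by
    rcases (Metric.closedBall (0 : En n) R ×ˢ Metric.sphere (0 : En n) 1).eq_empty_or_nonempty
      with he | hne
    · exact ⟨1, one_pos, by simp [he]⟩
    · obtain ⟨z, hz, hmin⟩ := hc.exists_isMinOn hne hcont.continuousOn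
      refine ⟨_, hB.pos z.1 z.2 ?_, fun w hw => hmin hw⟩
      rintro h0
      have := hz.2
      simp [h0] at this
  refine ⟨c, hc0, fun x ξ hx => ?_⟩
  by_cases hξ : ξ = 0
  · simp [hξ]
  have hpos : 0 < ‖ξ‖ := norm_pos_iff.2 hξ
  have h1 := hc1 (x, ‖ξ‖⁻¹ • ξ) ⟨by simpa using hx, by simp [norm_smul, hpos.ne']⟩
  simp only [map_smul, inner_smul_left, inner_smul_right] at h1
  simp only [map_inv₀, conj_trivial] at h1
  have h2 := mul_le_mul_of_nonneg_right h1 (sq_nonneg ‖ξ‖)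
  refine h2.trans_eq ?_
  field_simp

theorem gronwallBound_smul (r K ε x : ℝ) :
    gronwallBound r K (r * ε) x = r * gronwallBound 1 K ε x := by
  unfold gronwallBound
  split_ifs <;> ring

/-- Continuous dependence at time `T` on the initial data and on the parameter `s` at `s = 0`. -/
theorem HamiltonianBounds.eventually_mem_of_trajectory (hB : HamiltonianBounds A V C)
    {y₀ η₀ : ℝ → En n} (h₀ : IsTrajectory A V 0 y₀ η₀) {T : ℝ} (hT : 0 ≤ T)
    {U : Set (En n × En n)} (hU : U ∈ 𝓝 (y₀ T, η₀ T)) :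
    ∀ᶠ p : ℝ × En n × En n in 𝓝 (0, y₀ 0, η₀ 0), 0 ≤ p.1 → ∀ y η : ℝ → En n,
      IsTrajectory A V p.1 y η → (y 0, η 0) = p.2 → (y T, η T) ∈ U := by
  set e := energy A V 0 (y₀ 0) (η₀ 0) + 1
  set S := √(C * (2 * (e + 2 * C ^ 2)))
  set R := ‖y₀ 0‖ + 1 + S * T
  obtain ⟨c, hc0, hc⟩ := hB.exists_coercive R
  set R' := √(2 * (e + 2 * C ^ 2) / c)
  set B := Metric.closedBall (0 : En n × En n) (max R R')
  have hmem : ∀ s, 0 ≤ s → s ≤ 1 → ∀ y η : ℝ → En n, IsTrajectory A V s y η →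
      energy A V s (y 0) (η 0) ≤ e → ‖y 0‖ ≤ ‖y₀ 0‖ + 1 → ∀ t ∈ Set.Ico 0 T, (y t, η t) ∈ B := by
    intro s hs hs1 y η h he hy t ht
    have h1 : ‖y t‖ ≤ R := by
      refine (h.norm_position_le hB hs hs1 he ht.1).trans ?_
      have := ht.2.le
      show ‖y 0‖ + S * t ≤ ‖y₀ 0‖ + 1 + S * T
      gcongr
    have h2 : ‖η t‖ ≤ R' := by
      apply Real.le_sqrt_of_sq_le
      rw [le_div_iff₀' hc0]
      refine (hc _ _ h1).trans ((hB.inner_le_energy hs hs1 _ _).trans ?_)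
      rw [h.energy_eq hB]
      gcongr
    rw [mem_closedBall_zero_iff, Prod.norm_def]
    exact max_le_max h1 h2
  have hBc : IsCompact B := isCompact_closedBall _ _
  set F : En n × En n → En n × En n := fun z => (A z.1 z.2, -kineticGradient A z.1 z.2)
  have hF : ContDiff ℝ 1 F :=
    (((hB.contDiff_A.of_le (by norm_num)).comp contDiff_fst).clm_apply contDiff_snd).prodMk
      (contDiff_kineticGradient hB.contDiff_A).neg
  obtain ⟨K, hK⟩ := hF.contDiffOn.exists_lipschitzOnWith one_ne_zero (convex_closedBall _ _) hBc
  obtain ⟨G, hG⟩ := hBc.exists_bound_of_continuousOn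
    (f := fun z : En n × En n => potentialGradient V z.1)
    ((continuous_potentialGradient hB.contDiff_V).comp continuous_fst).continuousOn
  obtain ⟨ρ, hρ, hρU⟩ := Metric.mem_nhds_iff.1 hU
  obtain ⟨r, hr, hrρ⟩ : ∃ r > 0, r * gronwallBound 1 K G T < ρ := by
    have : Tendsto (fun r : ℝ => r * gronwallBound 1 K G T) (𝓝[>] 0) (𝓝 0) := by
      have : Tendsto (fun r : ℝ => r * gronwallBound 1 K G T) (𝓝 0) (𝓝 (0 * _)) :=
        tendsto_id.mul_const _
      rw [zero_mul] at this
      exact this.mono_left nhdsWithin_le_nhds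
    obtain ⟨r, h1, h2⟩ := ((this.eventually (gt_mem_nhds hρ)).and self_mem_nhdsWithin).exists
    exact ⟨r, h2, h1⟩
  have hev1 : ∀ᶠ p : ℝ × En n × En n in 𝓝 (0, y₀ 0, η₀ 0),
      energy A V p.1 p.2.1 p.2.2 < e :=
    hB.continuous_energy.continuousAt.eventually (gt_mem_nhds (by simp [e]))
  have hev2 := Metric.ball_mem_nhds ((0 : ℝ), y₀ 0, η₀ 0) (lt_min hr one_pos)
  filter_upwards [hev1, hev2] with p hp1 hp2 hs y η h hyη
  obtain ⟨s, x, ξ⟩ := p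
  simp only [Prod.mk.injEq] at hyη
  obtain ⟨rfl, rfl⟩ := hyη
  simp only [Metric.mem_ball, Prod.dist_eq, lt_min_iff, max_lt_iff, Real.dist_eq, sub_zero,
    abs_of_nonneg hs] at hp1 hp2 hs
  have hy : ‖y 0‖ ≤ ‖y₀ 0‖ + 1 := by
    have := norm_le_norm_add_norm_sub' (y 0) (y₀ 0)
    rw [← dist_eq_norm] at this
    linarith [hp2.2.2.1]
  have hin := hmem s hs hp2.2.1.le y η h hp1.le hy
  have hin₀ := hmem 0 le_rfl zero_le_one y₀ η₀ h₀ (by simp [e]) (by simp)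
  have hd : ∀ t, HasDerivAt (fun τ => (y τ, η τ)) _ t := fun t =>
    (h.position t).prodMk (h.momentum t)
  have hd₀ : ∀ t, HasDerivAt (fun τ => (y₀ τ, η₀ τ)) _ t := fun t =>
    (h₀.position t).prodMk (h₀.momentum t)
  have hgr := dist_le_of_approx_trajectories_ODE_of_mem (v := fun _ => F) (s := fun _ => B)
    (K := K) (a := 0) (b := T) (εf := r * G) (εg := 0) (δ := r) (fun _ _ => hK)
    (fun t _ => (hd t).continuousAt.continuousWithinAt) (fun t _ => (hd t).hasDerivWithinAt)
    (fun t ht => by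
      have h1 := hG _ (hin t ht)
      have h2 : (A (y t) (η t), -(kineticGradient A (y t) (η t) + s • potentialGradient V (y t)))
          - F (y t, η t) = (0, -(s • potentialGradient V (y t))) := by
        simp [F]
      rw [dist_eq_norm, h2, Prod.norm_def, norm_zero, norm_neg, norm_smul, Real.norm_of_nonneg hs]
      rw [max_eq_right (by positivity)]
      exact mul_le_mul hp2.1.1.le h1 (norm_nonneg _) hr.le)
    hin (fun t _ => (hd₀ t).continuousAt.continuousWithinAt)
    (fun t _ => (hd₀ t).hasDerivWithinAt)
    (fun t _ => by simp [F]) hin₀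
    (by rw [Prod.dist_eq]; exact max_le hp2.1.2.1.le hp2.1.2.2.le) T ⟨hT, le_rfl⟩
  rw [add_zero, sub_zero, gronwallBound_smul] at hgr
  exact hρU (hgr.trans_lt hrρ)

/-- Outside a large ball, the second derivative of `|y|²/2` is bounded below by the energy. -/
theorem HamiltonianBounds.energy_le_of_far (hB : HamiltonianBounds A V C) (hs : 0 ≤ s)
    (x ξ : En n) (hx : 32 * C ≤ ‖x‖) :
    energy A V s x ξ / 8 - 4 * C * s * (1 + ‖x‖ ^ 2) ≤
      ‖A x ξ‖ ^ 2 + inner ℝ x (fderiv ℝ A x (A x ξ) ξ)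
        - inner ℝ (kineticGradient A x ξ + s • potentialGradient V x) (A x x) := by
  have hC := hB.one_le
  have hx0 : 0 < ‖x‖ := by linarith
  have hI : ‖A x - 1‖ ≤ 1 / 2 := by
    have := hB.norm_sub_one_le x
    by_contra! hlt
    nlinarith
  have hD : ‖x‖ * ‖fderiv ℝ A x‖ ≤ 1 / 32 := by
    have := hB.norm_fderiv_A_le x
    by_contra! hlt
    nlinarith
  have hsub : ∀ v, ‖A x v - v‖ ≤ 1 / 2 * ‖v‖ := fun v => by
    simpa using (A x - 1).le_of_opNorm_le hI v
  have hup : ∀ v, ‖A x v‖ ≤ 3 / 2 * ‖v‖ := fun v => by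
    linarith [hsub v, norm_le_norm_add_norm_sub' (A x v) v]
  have hlow : 1 / 2 * ‖ξ‖ ≤ ‖A x ξ‖ := by
    linarith [hsub ξ, norm_le_norm_add_norm_sub (A x ξ) ξ]
  have hDv : ∀ v, ‖fderiv ℝ A x v ξ‖ ≤ ‖fderiv ℝ A x‖ * ‖v‖ * ‖ξ‖ := fun v =>
    ((fderiv ℝ A x v).le_opNorm ξ).trans (by gcongr; exact (fderiv ℝ A x).le_opNorm v)
  have t1 : -(3 / 64 * ‖ξ‖ ^ 2) ≤ inner ℝ x (fderiv ℝ A x (A x ξ) ξ) := by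
    refine neg_le_of_abs_le ((abs_real_inner_le_norm _ _).trans ?_)
    calc ‖x‖ * ‖fderiv ℝ A x (A x ξ) ξ‖
        ≤ ‖x‖ * (‖fderiv ℝ A x‖ * (3 / 2 * ‖ξ‖) * ‖ξ‖) := by
          gcongr
          exact (hDv _).trans (by gcongr; exact hup ξ)
      _ = (‖x‖ * ‖fderiv ℝ A x‖) * (3 / 2 * ‖ξ‖ ^ 2) := by ring
      _ ≤ 1 / 32 * (3 / 2 * ‖ξ‖ ^ 2) := by gcongr
      _ = _ := by ring
  have t2 : inner ℝ ξ (fderiv ℝ A x (A x x) ξ) ≤ 3 / 64 * ‖ξ‖ ^ 2 := by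
    refine (real_inner_le_norm _ _).trans ?_
    calc ‖ξ‖ * ‖fderiv ℝ A x (A x x) ξ‖
        ≤ ‖ξ‖ * (‖fderiv ℝ A x‖ * (3 / 2 * ‖x‖) * ‖ξ‖) := by
          gcongr
          exact (hDv _).trans (by gcongr; exact hup x)
      _ = (‖x‖ * ‖fderiv ℝ A x‖) * (3 / 2 * ‖ξ‖ ^ 2) := by ring
      _ ≤ 1 / 32 * (3 / 2 * ‖ξ‖ ^ 2) := by gcongr
      _ = _ := by ring
  have t3 : inner ℝ x (A x x) ≤ 3 / 2 * ‖x‖ ^ 2 := by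
    refine (real_inner_le_norm _ _).trans ?_
    nlinarith [hup x]
  have t4 : fderiv ℝ V x (A x x) ≤ C * (3 / 2 * ‖x‖) :=
    (le_abs_self _).trans (((fderiv ℝ V x).le_of_opNorm_le (hB.norm_fderiv_V_le x) _).trans
      (by gcongr; exact hup x))
  have t5 : inner ℝ (A x ξ) ξ ≤ 3 / 2 * ‖ξ‖ ^ 2 := by
    refine (real_inner_le_norm _ _).trans ?_
    nlinarith [hup ξ, norm_nonneg ξ]
  have t6 : V x ≤ C * (1 + ‖x‖) := (le_abs_self _).trans (hB.abs_V_le x)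
  have t7 : 1 / 4 * ‖ξ‖ ^ 2 ≤ ‖A x ξ‖ ^ 2 := by nlinarith [norm_nonneg ξ]
  have t8 : inner ℝ x (A x x) + fderiv ℝ V x (A x x) + (‖x‖ ^ 2 / 2 + V x) / 8 ≤
      4 * C * (1 + ‖x‖ ^ 2) := by nlinarith [sq_nonneg (‖x‖ - 1)]
  have t9 := mul_le_mul_of_nonneg_left t8 hs
  rw [inner_add_left, inner_smul_left, inner_kineticGradient, inner_potentialGradient, energy]
  simp only [conj_trivial]
  nlinarith [sq_nonneg ‖ξ‖]

theorem IsTrajectory.hasDerivAt_inner (hB : HamiltonianBounds A V C)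
    (h : IsTrajectory A V s y η) (t : ℝ) :
    HasDerivAt (fun τ => inner ℝ (y τ) (A (y τ) (η τ)))
      (‖A (y t) (η t)‖ ^ 2 + inner ℝ (y t) (fderiv ℝ A (y t) (A (y t) (η t)) (η t))
        - inner ℝ (kineticGradient A (y t) (η t) + s • potentialGradient V (y t))
            (A (y t) (y t))) t := by
  refine ((h.position t).inner ℝ
    ((h.hasDerivAt_A hB.contDiff_A t).clm_apply (h.momentum t))).congr_deriv ?_
  rw [inner_add_right, map_neg, inner_neg_right, ← hB.symm, real_inner_self_eq_norm_sq,
    real_inner_comm (A (y t) (y t))]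
  ring

/-- A function that is convex wherever it exceeds `R`, and increasing at a time when it does,
grows quadratically from then on. -/
theorem quadratic_growth_of_convex_far {φ w w' : ℝ → ℝ} {T S R c : ℝ}
    (hφ : ∀ t, HasDerivAt φ (2 * w t) t) (hw : ∀ t, HasDerivAt w (w' t) t) (hc : 0 ≤ c)
    (hφT : R ≤ φ T) (hwT : 0 < w T) (hfar : ∀ t ∈ Set.Icc T S, R ≤ φ t → c ≤ w' t) :
    ∀ t ∈ Set.Icc T S, R + c * (t - T) ^ 2 ≤ φ t := by
  have hwc : Continuous w := continuous_iff_continuousAt.2 fun t => (hw t).continuousAt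
  have hφc : Continuous φ := continuous_iff_continuousAt.2 fun t => (hφ t).continuousAt
  have hstep : ∀ τ ∈ Set.Icc T S, (∀ t ∈ Set.Ioo T τ, 0 ≤ w t) → R ≤ φ τ := by
    intro τ hτ hpos
    have hm : MonotoneOn φ (Set.Icc T τ) := by
      refine monotoneOn_of_deriv_nonneg (convex_Icc _ _) hφc.continuousOn
        (fun t _ => (hφ t).differentiableAt.differentiableWithinAt) fun t ht => ?_
      rw [interior_Icc] at ht
      rw [(hφ t).deriv]
      linarith [hpos t ht]
    exact hφT.trans (hm ⟨le_rfl, hτ.1⟩ ⟨hτ.1, le_rfl⟩ hτ.1)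
  have hlin : ∀ τ ∈ Set.Icc T S, (∀ t ∈ Set.Ioo T τ, 0 ≤ w t) → w T + c * (τ - T) ≤ w τ := by
    intro τ hτ hpos
    have hd : ∀ t, HasDerivAt (fun t => w t - c * (t - T)) (w' t - c * 1) t := fun t =>
      (hw t).sub (((hasDerivAt_id t).sub_const T).const_mul c)
    have hm : MonotoneOn (fun t => w t - c * (t - T)) (Set.Icc T τ) := by
      refine monotoneOn_of_deriv_nonneg (convex_Icc _ _) (by fun_prop)
        (fun t _ => (hd t).differentiableAt.differentiableWithinAt) fun t ht => ?_
      rw [interior_Icc] at ht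
      have htS : t ∈ Set.Icc T S := ⟨ht.1.le, ht.2.le.trans hτ.2⟩
      rw [(hd t).deriv]
      linarith [hfar t htS (hstep t htS fun u hu => hpos u ⟨hu.1, hu.2.trans ht.2⟩)]
    have := hm ⟨le_rfl, hτ.1⟩ ⟨hτ.1, le_rfl⟩ hτ.1
    simp only [sub_self, mul_zero, sub_zero] at this
    linarith
  have hwpos : ∀ t ∈ Set.Icc T S, 0 < w t := by
    by_contra! hex
    have hcpt : IsCompact (Set.Icc T S ∩ {t | w t ≤ 0}) :=
      isCompact_Icc.inter_right (isClosed_le hwc continuous_const)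
    obtain ⟨τ, ⟨hτ, hτw⟩, hmin⟩ := hcpt.exists_isLeast hex
    have := hlin τ hτ fun t ht => by
      by_contra! hlt
      exact absurd (hmin ⟨⟨ht.1.le, ht.2.le.trans hτ.2⟩, hlt.le⟩) (not_le.2 ht.2)
    have h2 : 0 ≤ c * (τ - T) := mul_nonneg hc (sub_nonneg.2 hτ.1)
    simp only [Set.mem_ofPred_eq] at hτw
    linarith
  intro τ hτ
  have hd : ∀ t, HasDerivAt (fun t => φ t - c * (t - T) ^ 2)
      (2 * w t - c * ((2 : ℕ) * (t - T) ^ (2 - 1) * 1)) t := fun t =>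
    (hφ t).sub ((((hasDerivAt_id t).sub_const T).pow 2).const_mul c)
  have hm : MonotoneOn (fun t => φ t - c * (t - T) ^ 2) (Set.Icc T τ) := by
    refine monotoneOn_of_deriv_nonneg (convex_Icc _ _) (by fun_prop)
      (fun t _ => (hd t).differentiableAt.differentiableWithinAt) fun t ht => ?_
    rw [interior_Icc] at ht
    rw [(hd t).deriv]
    have := hlin t ⟨ht.1.le, ht.2.le.trans hτ.2⟩ fun u hu =>
      (hwpos u ⟨hu.1.le, hu.2.le.trans (ht.2.le.trans hτ.2)⟩).le
    norm_num
    linarith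
  have := hm ⟨le_rfl, hτ.1⟩ ⟨hτ.1, le_rfl⟩ hτ.1
  simp only [sub_self] at this
  linarith

theorem HamiltonianBounds.energy_pos_of_tendsto (hB : HamiltonianBounds A V C)
    (h : IsTrajectory A V 0 y η) (hnt : Tendsto (fun t => ‖y t‖) atTop atTop) :
    0 < energy A V 0 (y 0) (η 0) := by
  have hnn : ∀ t, 0 ≤ energy A V 0 (y t) (η t) := fun t => by
    simpa [energy] using div_nonneg (hB.inner_nonneg (y t) (η t)) zero_le_two
  refine (hnn 0).lt_of_ne fun h0 => ?_
  have hη : ∀ t, η t = 0 := fun t => by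
    by_contra hne
    have := hB.pos (y t) (η t) hne
    have h1 := h.energy_eq hB t
    rw [← h0] at h1
    simp only [energy, zero_mul, add_zero] at h1
    linarith
  have hy : ∀ t, y t = y 0 := fun t =>
    is_const_of_deriv_eq_zero (fun t => (h.position t).differentiableAt)
      (fun t => by rw [(h.position t).deriv, hη t, map_zero]) t 0
  simp only [hy] at hnt
  exact not_tendsto_const_atTop _ _ hnt

theorem IsTrajectory.exists_far_outgoing (h : IsTrajectory A V s y η)
    (hnt : Tendsto (fun t => ‖y t‖) atTop atTop) (R : ℝ) :
    ∃ T, 0 ≤ T ∧ R < ‖y T‖ ∧ 0 < inner ℝ (y T) (A (y T) (η T)) := by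
  obtain ⟨T₁, hT₁⟩ := eventually_atTop.1
    ((hnt.eventually_gt_atTop R).and (eventually_ge_atTop 0))
  obtain ⟨T₂, h1, h2⟩ := ((hnt.eventually_gt_atTop ‖y T₁‖).and (eventually_gt_atTop T₁)).exists
  obtain ⟨T, hT, hslope⟩ := exists_hasDerivAt_eq_slope _ _ h2
    (fun t _ => (h.position t).norm_sq.continuousAt.continuousWithinAt)
    (fun t _ => (h.position t).norm_sq)
  have h3 := hT₁ T hT.1.le
  refine ⟨T, h3.2, h3.1, ?_⟩
  have h4 : ‖y T₁‖ ^ 2 < ‖y T₂‖ ^ 2 := by gcongr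
  have h5 : 0 < (‖y T₂‖ ^ 2 - ‖y T₁‖ ^ 2) / (T₂ - T₁) :=
    div_pos (sub_pos.2 h4) (sub_pos.2 h2)
  rw [← hslope] at h5
  linarith

theorem HamiltonianBounds.escape (hB : HamiltonianBounds A V C) {y₀ η₀ : ℝ → En n}
    (h₀ : IsTrajectory A V 0 y₀ η₀) (hnt : Tendsto (fun t => ‖y₀ t‖) atTop atTop) :
    ∃ δ > 0, ∃ c₁ > 0, ∃ c₂ > 0, ∀ᶠ p : ℝ × En n × En n in 𝓝 (0, y₀ 0, η₀ 0),
      0 ≤ p.1 → ∀ y η : ℝ → En n, IsTrajectory A V p.1 y η → (y 0, η 0) = p.2 →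
        ∀ t, 0 ≤ t → p.1 * t ^ 2 ≤ δ ^ 2 → c₁ * t - c₂ ≤ ‖y t‖ := by
  have hC := hB.one_le
  have hk := hB.energy_pos_of_tendsto h₀ hnt
  set k := energy A V 0 (y₀ 0) (η₀ 0)
  obtain ⟨T, hT, hR, hw⟩ := h₀.exists_far_outgoing hnt (32 * C)
  have hA := hB.contDiff_A.continuous
  have hU : {z : En n × En n | 32 * C < ‖z.1‖ ∧ 0 < inner ℝ z.1 (A z.1 z.2)} ∈
      𝓝 (y₀ T, η₀ T) := by
    refine IsOpen.mem_nhds ?_ ⟨hR, hw⟩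
    exact (isOpen_lt (by fun_prop) (by fun_prop) :
        IsOpen {z : En n × En n | 32 * C < ‖z.1‖}).inter
      (isOpen_lt (by fun_prop) (by fun_prop) :
        IsOpen {z : En n × En n | 0 < inner ℝ z.1 (A z.1 z.2)})
  set S := √(C * (2 * (2 * k + 2 * C ^ 2)))
  set X := ‖y₀ 0‖ + 1
  set Q := 4 * C * (1 + 2 * X ^ 2 + 2 * S ^ 2)
  have hQ : 0 < Q := by positivity
  set m := min 1 (k / (32 * Q))
  have hm : 0 < m := by positivity
  have hQm : Q * m ≤ k / 32 := by
    calc Q * m ≤ Q * (k / (32 * Q)) := by gcongr; exact min_le_right _ _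
      _ = k / 32 := by field_simp
  refine ⟨√m, by positivity, √(k / 32), by positivity, √(k / 32) * T + 1, by positivity, ?_⟩
  filter_upwards [hB.eventually_mem_of_trajectory h₀ hT hU,
    hB.continuous_energy.continuousAt.eventually (lt_mem_nhds (show k / 2 < k by linarith)),
    hB.continuous_energy.continuousAt.eventually (gt_mem_nhds (show k < 2 * k by linarith)),
    Metric.ball_mem_nhds ((0 : ℝ), y₀ 0, η₀ 0) hm] with p hpU hp1 hp2 hpm hs y η h hyη t ht hst
  obtain ⟨hRT, hwT⟩ := hpU hs y η h hyη
  obtain ⟨s, x, ξ⟩ := p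
  simp only [Prod.mk.injEq] at hyη
  obtain ⟨rfl, rfl⟩ := hyη
  simp only [Metric.mem_ball, Prod.dist_eq, max_lt_iff, Real.dist_eq, sub_zero] at hp1 hp2 hpm hs hst
  rw [Real.sq_sqrt hm.le] at hst
  rw [abs_of_nonneg hs] at hpm
  have hs1 : s ≤ 1 := hpm.1.le.trans (min_le_left _ _)
  have hX : ‖y 0‖ ≤ X := by
    have h1 := norm_le_norm_add_norm_sub' (y 0) (y₀ 0)
    rw [← dist_eq_norm] at h1
    have h2 : m ≤ 1 := min_le_left _ _
    linarith [hpm.2.1]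
  have hSk : 0 ≤ √(k / 32) := Real.sqrt_nonneg _
  rcases lt_or_ge t T with htT | htT
  · nlinarith [norm_nonneg (y t)]
  have hgrow := quadratic_growth_of_convex_far (φ := fun τ => ‖y τ‖ ^ 2) (T := T) (S := t)
    (R := (32 * C) ^ 2) (c := k / 32) (fun τ => (h.position τ).norm_sq)
    (h.hasDerivAt_inner hB) (by positivity) (by gcongr) hwT
    (fun τ hτ hfar => by
      have hfar' : 32 * C ≤ ‖y τ‖ := le_of_sq_le_sq hfar (norm_nonneg _)
      refine le_trans ?_ (hB.energy_le_of_far hs (y τ) (η τ) hfar')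
      have hτ0 : 0 ≤ τ := hT.trans hτ.1
      have hpos := h.norm_position_le hB hs hs1 hp2.le hτ0
      have h1 : ‖y τ‖ ≤ X + S * τ := hpos.trans (by gcongr)
      have h2 : ‖y τ‖ ^ 2 ≤ 2 * X ^ 2 + 2 * S ^ 2 * τ ^ 2 := by
        have : ‖y τ‖ ^ 2 ≤ (X + S * τ) ^ 2 := by gcongr
        nlinarith [sq_nonneg (X - S * τ)]
      have h3 : s * τ ^ 2 ≤ m := le_trans (by gcongr; exact hτ.2) hst
      have h4 : 4 * C * s * (1 + ‖y τ‖ ^ 2) ≤ Q * m := by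
        calc 4 * C * s * (1 + ‖y τ‖ ^ 2)
            ≤ 4 * C * s * (1 + (2 * X ^ 2 + 2 * S ^ 2 * τ ^ 2)) := by gcongr
          _ = 4 * C * ((1 + 2 * X ^ 2) * s + 2 * S ^ 2 * (s * τ ^ 2)) := by ring
          _ ≤ 4 * C * ((1 + 2 * X ^ 2) * m + 2 * S ^ 2 * m) := by
            gcongr
            exact hpm.1.le
          _ = Q * m := by ring
      rw [h.energy_eq hB]
      linarith) t ⟨htT, le_rfl⟩
  have hle : √(k / 32) * (t - T) ≤ ‖y t‖ := by
    refine le_of_sq_le_sq ?_ (norm_nonneg _)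
    rw [mul_pow, Real.sq_sqrt (by positivity)]
    nlinarith [sq_nonneg (32 * C)]
  linarith

end Escape

section Coordinates

variable {n : ℕ} {a : Fin n → Fin n → En n → ℝ} {V : En n → ℝ} {μ : ℝ}

/-- The elementary matrix with entry `1` at `(j, k)`, as an operator. -/
noncomputable def matrixUnit {n : ℕ} (j k : Fin n) : En n →L[ℝ] En n :=
  (EuclideanSpace.proj k : En n →L[ℝ] ℝ).smulRight (EuclideanSpace.single j 1)

/-- The operator with matrix `(a_{jk}(x))`. -/
noncomputable def coefficientOperator {n : ℕ} (a : Fin n → Fin n → En n → ℝ) (x : En n) :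
    En n →L[ℝ] En n :=
  ∑ j, ∑ k, a j k x • matrixUnit j k

theorem sum_smul_matrixUnit_apply (b : Fin n → Fin n → ℝ) (ξ : En n) (i : Fin n) :
    (∑ j, ∑ k, b j k • matrixUnit j k) ξ i = ∑ k, b i k * ξ k := by
  simp only [matrixUnit, _root_.sum_apply, _root_.smul_apply,
    ContinuousLinearMap.smulRight_apply, PiLp.proj_apply, WithLp.ofLp_sum,
    WithLp.ofLp_smul, Finset.sum_apply, Pi.smul_apply, smul_eq_mul, PiLp.single_apply]
  rw [Finset.sum_eq_single i]
  · simp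
  · intro j _ hj
    simp [hj.symm]
  · simp

theorem inner_sum_smul_matrixUnit (b : Fin n → Fin n → ℝ) (ξ v : En n) :
    inner ℝ ((∑ j, ∑ k, b j k • matrixUnit j k) ξ) v = ∑ j, ∑ k, b j k * v j * ξ k := by
  rw [PiLp.inner_apply]
  refine Finset.sum_congr rfl fun j _ => ?_
  rw [sum_smul_matrixUnit_apply, RCLike.inner_apply, conj_trivial, Finset.mul_sum]
  exact Finset.sum_congr rfl fun k _ => by ring

theorem sum_kdelta_smul_matrixUnit :
    ∑ j, ∑ k, kdelta j k • matrixUnit j k = (1 : En n →L[ℝ] En n) := by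
  ext ξ i
  rw [sum_smul_matrixUnit_apply]
  simp [kdelta]

theorem coefficientOperator_sub_one (x : En n) :
    coefficientOperator a x - 1 = ∑ j, ∑ k, (a j k x - kdelta j k) • matrixUnit j k := by
  rw [coefficientOperator, ← sum_kdelta_smul_matrixUnit, ← Finset.sum_sub_distrib]
  refine Finset.sum_congr rfl fun j _ => ?_
  rw [← Finset.sum_sub_distrib]
  exact Finset.sum_congr rfl fun k _ => (sub_smul _ _ _).symm

theorem two_le_top : (2 : WithTop ℕ∞) ≤ ((⊤ : ℕ∞) : WithTop ℕ∞) :=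
  WithTop.coe_le_coe.2 (le_top : (2 : ℕ∞) ≤ ⊤)

theorem AssumptionA.contDiff_coefficientOperator (hA : AssumptionA n a V μ) :
    ContDiff ℝ 2 (coefficientOperator a) :=
  ContDiff.sum fun j _ => ContDiff.sum fun k _ =>
    ((hA.smooth_a j k).of_le two_le_top).smul contDiff_const

theorem AssumptionA.fderiv_coefficientOperator (hA : AssumptionA n a V μ) (x v : En n) :
    fderiv ℝ (coefficientOperator a) x v =
      ∑ j, ∑ k, fderiv ℝ (a j k) x v • matrixUnit j k := by
  have hd : ∀ j k, HasFDerivAt (fun x => a j k x • matrixUnit j k)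
      ((fderiv ℝ (a j k) x).smulRight (matrixUnit j k)) x := fun j k =>
    HasFDerivAt.smul_const (F := En n →L[ℝ] En n)
      (((hA.smooth_a j k).differentiable (by simp)) x).hasFDerivAt (matrixUnit j k)
  have h := HasFDerivAt.fun_sum fun j (_ : j ∈ Finset.univ) =>
    HasFDerivAt.fun_sum fun k (_ : k ∈ Finset.univ) => hd j k
  have h' : HasFDerivAt (coefficientOperator a) _ x := h
  rw [h'.fderiv]
  simp

theorem one_le_jb (x : En n) : 1 ≤ jb x :=
  Real.one_le_sqrt.2 (by nlinarith [sq_nonneg ‖x‖])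

theorem norm_le_jb (x : En n) : ‖x‖ ≤ jb x :=
  Real.le_sqrt_of_sq_le (by linarith)

theorem jb_le (x : En n) : jb x ≤ 1 + ‖x‖ :=
  Real.sqrt_le_iff.2 ⟨by positivity, by nlinarith [norm_nonneg x]⟩

theorem norm_pow_mul_le_of_le_jb_rpow {m : ℕ} {C p b : ℝ} {x : En n} (hC : 0 ≤ C)
    (hp : p ≤ -m) (hb : b ≤ C * jb x ^ p) : ‖x‖ ^ m * b ≤ C := by
  have hj := one_le_jb x
  have hj0 : 0 < jb x := by linarith
  calc ‖x‖ ^ m * b ≤ ‖x‖ ^ m * (C * jb x ^ p) := by gcongr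
    _ ≤ jb x ^ m * (C * jb x ^ (-m : ℝ)) := by
      gcongr
      exact norm_le_jb x
    _ = C := by
      rw [Real.rpow_neg hj0.le, Real.rpow_natCast]
      field_simp

theorem AssumptionA.hamiltonianBounds (hA : AssumptionA n a V μ) :
    ∃ C, HamiltonianBounds (coefficientOperator a) V C := by
  have hμ := hA.one_lt_mu
  choose C₀ hC₀ hb₀ using hA.decay_a 0
  choose C₁ hC₁ hb₁ using hA.decay_a 1
  obtain ⟨D₀, hD₀, hV₀⟩ := hA.decay_V 0
  obtain ⟨D₁, hD₁, hV₁⟩ := hA.decay_V 1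
  set S₀ := ∑ j, ∑ k, C₀ j k * ‖matrixUnit j k‖
  set S₁ := ∑ j, ∑ k, C₁ j k * ‖matrixUnit j k‖
  have hS₀ : 0 ≤ S₀ := Finset.sum_nonneg fun j _ => Finset.sum_nonneg fun k _ =>
    mul_nonneg (hC₀ j k).le (norm_nonneg _)
  have hS₁ : 0 ≤ S₁ := Finset.sum_nonneg fun j _ => Finset.sum_nonneg fun k _ =>
    mul_nonneg (hC₁ j k).le (norm_nonneg _)
  have hsum : ∀ (c : ℝ) (b D : Fin n → Fin n → ℝ), 0 ≤ c → (∀ j k, c * |b j k| ≤ D j k) →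
      c * ‖∑ j, ∑ k, b j k • matrixUnit j k‖ ≤ ∑ j, ∑ k, D j k * ‖matrixUnit j k‖ := by
    intro c b D hc hbD
    calc c * ‖∑ j, ∑ k, b j k • matrixUnit j k‖
        ≤ c * ∑ j, ∑ k, |b j k| * ‖matrixUnit j k‖ := by
          gcongr
          refine norm_sum_le_of_le _ fun j _ => norm_sum_le_of_le _ fun k _ => ?_
          rw [norm_smul, Real.norm_eq_abs]
      _ = ∑ j, ∑ k, c * |b j k| * ‖matrixUnit j k‖ := by
          simp only [Finset.mul_sum, mul_assoc]
      _ ≤ _ := by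
          gcongr with j _ k _
          exact hbD j k
  have hsub : ∀ x (m : ℕ), m ≤ 1 → ‖x‖ ^ m * ‖coefficientOperator a x - 1‖ ≤ S₀ := by
    intro x m hm
    rw [coefficientOperator_sub_one]
    refine hsum _ _ _ (by positivity) fun j k => ?_
    have h := hb₀ j k x
    rw [norm_iteratedFDeriv_zero, Real.norm_eq_abs] at h
    have : (m : ℝ) ≤ 1 := by exact_mod_cast hm
    exact norm_pow_mul_le_of_le_jb_rpow (hC₀ j k).le (by push_cast; linarith) h
  refine ⟨1 + S₀ + S₁ + D₀ + D₁, by linarith, hA.contDiff_coefficientOperator,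
    hA.smooth_V.of_le two_le_top, fun x u v => ?_, fun x ξ hξ => ?_,
    fun x => ?_, fun x => ?_, fun x => ?_, fun x => ?_, fun x => ?_⟩
  · rw [real_inner_comm, coefficientOperator, real_inner_comm, inner_sum_smul_matrixUnit,
      real_inner_comm, inner_sum_smul_matrixUnit, Finset.sum_comm]
    refine Finset.sum_congr rfl fun j _ => Finset.sum_congr rfl fun k _ => ?_
    rw [hA.symm k j]
    ring
  · rw [coefficientOperator, inner_sum_smul_matrixUnit]
    exact hA.posdef x ξ hξ
  · have h1 := hsub x 0 zero_le_one
    have h2 := norm_le_norm_add_norm_sub' (coefficientOperator a x) 1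
    have h3 : ‖(1 : En n →L[ℝ] En n)‖ ≤ 1 := ContinuousLinearMap.norm_id_le
    rw [pow_zero, one_mul] at h1
    linarith
  · have h1 := hsub x 1 le_rfl
    rw [pow_one] at h1
    linarith
  · have h1 : ‖x‖ ^ 2 * ‖fderiv ℝ (coefficientOperator a) x‖ ≤ S₁ := by
      rcases eq_or_ne x 0 with rfl | hx
      · simpa using hS₁
      have hx2 : 0 < ‖x‖ ^ 2 := by positivity
      rw [← le_div_iff₀' hx2]
      refine ContinuousLinearMap.opNorm_le_bound _ (by positivity) fun v => ?_
      rw [hA.fderiv_coefficientOperator, div_mul_eq_mul_div, le_div_iff₀' hx2, Finset.sum_mul]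
      refine (hsum _ _ (fun j k => C₁ j k * ‖v‖) hx2.le fun j k => ?_).trans_eq ?_
      · have h := hb₁ j k x
        rw [norm_iteratedFDeriv_one, fderiv_sub_const] at h
        calc ‖x‖ ^ 2 * |fderiv ℝ (a j k) x v|
            ≤ ‖x‖ ^ 2 * (‖fderiv ℝ (a j k) x‖ * ‖v‖) := by
              gcongr
              exact (fderiv ℝ (a j k) x).le_opNorm v
          _ = (‖x‖ ^ 2 * ‖fderiv ℝ (a j k) x‖) * ‖v‖ := by ring
          _ ≤ C₁ j k * ‖v‖ := by
              gcongr
              exact norm_pow_mul_le_of_le_jb_rpow (hC₁ j k).le (by push_cast; linarith) h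
      · refine Finset.sum_congr rfl fun j _ => ?_
        rw [Finset.sum_mul]
        exact Finset.sum_congr rfl fun k _ => by ring
    linarith
  · have h := hV₀ x
    rw [norm_iteratedFDeriv_zero, Real.norm_eq_abs] at h
    have h1 : jb x ^ (2 - μ - ((0 : ℕ) : ℝ)) ≤ 1 + ‖x‖ := by
      refine (Real.rpow_le_rpow_of_exponent_le (one_le_jb x) (?_ : _ ≤ (1 : ℝ))).trans ?_
      · push_cast
        linarith
      · rw [Real.rpow_one]
        exact jb_le x
    refine h.trans (mul_le_mul ?_ h1 (Real.rpow_nonneg (by linarith [one_le_jb x]) _) ?_) <;>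
      linarith
  · have h := hV₁ x
    rw [norm_iteratedFDeriv_one] at h
    have h1 := norm_pow_mul_le_of_le_jb_rpow (m := 0) hD₁.le (by push_cast; linarith) h
    rw [pow_zero, one_mul] at h1
    linarith

theorem AssumptionA.kineticGradient_apply (hA : AssumptionA n a V μ) (x ξ : En n) (j : Fin n) :
    kineticGradient (coefficientOperator a) x ξ j =
      (1 / 2) * ∑ i, ∑ l, pd (a i l) j x * ξ i * ξ l := by
  have h := inner_kineticGradient (A := coefficientOperator a) x ξ (EuclideanSpace.single j 1)
  rw [EuclideanSpace.inner_single_right, real_inner_comm, hA.fderiv_coefficientOperator,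
    inner_sum_smul_matrixUnit] at h
  simp only [one_mul, conj_trivial] at h
  rw [h]
  simp only [pd]
  ring

theorem potentialGradient_apply (x : En n) (j : Fin n) :
    potentialGradient V x j = x j + pd V j x := by
  have h := inner_potentialGradient (V := V) x (EuclideanSpace.single j 1)
  rw [EuclideanSpace.inner_single_right, EuclideanSpace.inner_single_right] at h
  simpa [pd] using h

theorem hasDerivAt_euclidean {f : ℝ → En n} {f' : En n} {t : ℝ}
    (h : ∀ j, HasDerivAt (fun τ => f τ j) (f' j) t) : HasDerivAt f f' t := by
  have h1 : HasDerivAt (fun τ => (f τ).ofLp) f'.ofLp t := hasDerivAt_pi.2 h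
  exact (PiLp.continuousLinearEquiv 2 ℝ (fun _ : Fin n => ℝ)).symm.hasFDerivAt.comp_hasDerivAt t h1

theorem IsFlowPlam.isTrajectory (hA : AssumptionA n a V μ) {lam : ℝ} {y η : ℝ → En n}
    (h : IsFlowPlam a V lam y η) :
    IsTrajectory (coefficientOperator a) V (1 / lam ^ 2) y η := by
  refine ⟨fun t => hasDerivAt_euclidean fun j => ?_, fun t => hasDerivAt_euclidean fun j => ?_⟩
  · exact (h.1 t j).congr_deriv (sum_smul_matrixUnit_apply (fun j k => a j k (y t)) _ _).symm
  · refine (h.2 t j).congr_deriv ?_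
    simp only [PiLp.neg_apply, PiLp.add_apply, PiLp.smul_apply, smul_eq_mul,
      hA.kineticGradient_apply, potentialGradient_apply]
    ring

theorem IsFlowK.isTrajectory (hA : AssumptionA n a V μ) {y η : ℝ → En n}
    (h : IsFlowK a y η) : IsTrajectory (coefficientOperator a) V 0 y η := by
  refine ⟨fun t => hasDerivAt_euclidean fun j => ?_, fun t => hasDerivAt_euclidean fun j => ?_⟩
  · exact (h.1 t j).congr_deriv (sum_smul_matrixUnit_apply (fun j k => a j k (y t)) _ _).symm
  · refine (h.2 t j).congr_deriv ?_
    simp only [PiLp.neg_apply, PiLp.add_apply, PiLp.smul_apply, smul_eq_mul,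
      hA.kineticGradient_apply, zero_mul, add_zero]

end Coordinates

/-- Lemma 2.1, escape estimate. Under Assumption A, if `(x₀,ξ₀)` is forward
nontrapping for `k`, then there are `δ > 0`, a neighborhood `Ω` of `(x₀,ξ₀)`, `λ₀ > 0` and
`c₁, c₂ > 0` such that for all `λ ≥ λ₀`, `(x,ξ) ∈ Ω` and `0 ≤ t ≤ λδ`, the position component
of the Hamilton flow of `p^λ` satisfies `|y^λ(t;x,ξ)| ≥ c₁ t − c₂`. -/
theorem stmt_0 {n : ℕ} (a : Fin n → Fin n → En n → ℝ) (V : En n → ℝ) (μ : ℝ)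
    (hA : AssumptionA n a V μ) (x₀ ξ₀ : En n) (y₀ η₀ : ℝ → En n)
    (hflow₀ : IsFlowK a y₀ η₀) (hy₀ : y₀ 0 = x₀) (hη₀ : η₀ 0 = ξ₀)
    (hnt : Filter.Tendsto (fun t => ‖y₀ t‖) Filter.atTop Filter.atTop) :
    ∃ δ > (0 : ℝ), ∃ Ω : Set (En n × En n), IsOpen Ω ∧ (x₀, ξ₀) ∈ Ω ∧
      ∃ lam₀ > (0 : ℝ), ∃ c₁ > (0 : ℝ), ∃ c₂ > (0 : ℝ), ∀ lam : ℝ, lam₀ ≤ lam →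
        ∀ x ξ : En n, (x, ξ) ∈ Ω →
          ∀ y η : ℝ → En n, IsFlowPlam a V lam y η → y 0 = x → η 0 = ξ →
            ∀ t : ℝ, 0 ≤ t → t ≤ lam * δ → c₁ * t - c₂ ≤ ‖y t‖ := by
  obtain ⟨C, hB⟩ := hA.hamiltonianBounds
  subst hy₀ hη₀
  obtain ⟨δ, hδ, c₁, hc₁, c₂, hc₂, hev⟩ := hB.escape (hflow₀.isTrajectory hA) hnt
  obtain ⟨r, hr, hball⟩ := Metric.eventually_nhds_iff_ball.1 hev
  refine ⟨δ, hδ, Metric.ball (y₀ 0, η₀ 0) r, Metric.isOpen_ball, Metric.mem_ball_self hr,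
    1 + 1 / r, by positivity, c₁, hc₁, c₂, hc₂, ?_⟩
  intro lam hlam x ξ hxξ y η hflow hy hη t ht htlam
  have hr' : 0 < 1 / r := by positivity
  have hlam0 : 0 < lam := by linarith
  have hsr : 1 / lam ^ 2 < r := by
    rw [div_lt_comm₀ (by positivity) hr]
    nlinarith
  refine hball (1 / lam ^ 2, x, ξ) ?_ (by positivity) y η (hflow.isTrajectory hA)
    (by rw [hy, hη]) t ht ?_
  · rw [Metric.mem_ball, Prod.dist_eq]
    refine max_lt ?_ hxξ
    rwa [Real.dist_eq, sub_zero, abs_of_pos (by positivity)]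
  · have h1 : t ^ 2 ≤ (lam * δ) ^ 2 := by gcongr
    rw [one_div_mul_eq_div, div_le_iff₀ (by positivity)]
    linarith
end

section
/- (Convexity escape lemma.) Let T₀ < T be real numbers, let f : [T₀,T] → ℝ be twice continuously differentiable with f'(T₀) > 0, let E > 0, and let g : ℝ → ℝ be nonincreasing with g(f(T₀)) ≤ E. Suppose f''(t) ≥ 3E − g(f(t)) for all t ∈ [T₀,T]. Then f(t) ≥ f(T₀) + E(t − T₀)² for all t ∈ [T₀,T]. -/
open Real Filter
open scoped BigOperators Topology

/-- A function differentiable on `[a, c]` whose derivative is nonnegative on `(a, b)`, with `b ≤ c`,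
is monotone on `[a, b]`. -/
theorem monotoneOn_Icc_of_hasDerivWithinAt_nonneg {a b c : ℝ} {f f' : ℝ → ℝ} (hbc : b ≤ c)
    (hf : ∀ t ∈ Set.Icc a c, HasDerivWithinAt f (f' t) (Set.Icc a c) t)
    (hf' : ∀ t ∈ Set.Ioo a b, 0 ≤ f' t) : MonotoneOn f (Set.Icc a b) := by
  have hsub : Set.Icc a b ⊆ Set.Icc a c := Set.Icc_subset_Icc_right hbc
  apply monotoneOn_of_hasDerivWithinAt_nonneg (convex_Icc a b) (f' := f')
  · exact fun t ht => ((hf t (hsub ht)).mono hsub).continuousWithinAt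
  · exact fun t ht => (hf t (hsub (interior_subset ht))).mono (interior_subset.trans hsub)
  · rwa [interior_Icc]

/-- If `f'` is positive at `a`, and `f''` is nonnegative wherever `f` is at least `f a`, then `f'`
stays positive. -/
theorem deriv_pos_of_deriv_two_nonneg_of_le {a b : ℝ} {f f' f'' : ℝ → ℝ}
    (hf : ∀ t ∈ Set.Icc a b, HasDerivWithinAt f (f' t) (Set.Icc a b) t)
    (hf' : ∀ t ∈ Set.Icc a b, HasDerivWithinAt f' (f'' t) (Set.Icc a b) t)
    (hpos : 0 < f' a) (h : ∀ t ∈ Set.Icc a b, f a ≤ f t → 0 ≤ f'' t) :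
    ∀ t ∈ Set.Icc a b, 0 < f' t := by
  by_contra! hneg
  obtain ⟨s, hs, hfs⟩ := hneg
  have hcont : ContinuousOn f' (Set.Icc a b) := fun t ht => (hf' t ht).continuousWithinAt
  have hcompact : IsCompact (Set.Icc a b ∩ f' ⁻¹' Set.Iic 0) :=
    isCompact_Icc.of_isClosed_subset
      (hcont.preimage_isClosed_of_isClosed isClosed_Icc isClosed_Iic) Set.inter_subset_left
  obtain ⟨c, ⟨hc, hfc⟩, hmin⟩ := hcompact.exists_isLeast ⟨s, hs, hfs⟩
  have hbefore : ∀ t ∈ Set.Ioo a c, 0 ≤ f' t := fun t ht => by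
    by_contra! hlt
    exact (hmin ⟨⟨ht.1.le, ht.2.le.trans hc.2⟩, hlt.le⟩).not_gt ht.2
  have hac : a ∈ Set.Icc a c := Set.left_mem_Icc.2 hc.1
  have hmono := monotoneOn_Icc_of_hasDerivWithinAt_nonneg hc.2 hf hbefore
  have hmono' := monotoneOn_Icc_of_hasDerivWithinAt_nonneg hc.2 hf' fun t ht =>
    h t ⟨ht.1.le, ht.2.le.trans hc.2⟩ (hmono hac ⟨ht.1.le, ht.2.le⟩ ht.1.le)
  exact (hpos.trans_le (hmono' hac (Set.right_mem_Icc.2 hc.1) hc.1)).not_ge hfc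

/-- convexity escape lemma. If `f` is twice continuously differentiable on
`[T₀,T]` with `f'(T₀) > 0`, `E > 0`, `g` is nonincreasing with `g(f(T₀)) ≤ E`, and
`f''(t) ≥ 3E − g(f(t))` on `[T₀,T]`, then `f(t) ≥ f(T₀) + E(t−T₀)²` on `[T₀,T]`. -/
theorem stmt_4 (T₀ T : ℝ) (hTT : T₀ < T) (f f' f'' : ℝ → ℝ)
    (hf : ∀ t ∈ Set.Icc T₀ T, HasDerivWithinAt f (f' t) (Set.Icc T₀ T) t)
    (hf' : ∀ t ∈ Set.Icc T₀ T, HasDerivWithinAt f' (f'' t) (Set.Icc T₀ T) t)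
    (hf'' : ContinuousOn f'' (Set.Icc T₀ T))
    (hpos : 0 < f' T₀) (E : ℝ) (hE : 0 < E)
    (g : ℝ → ℝ) (hg : Antitone g) (hgE : g (f T₀) ≤ E)
    (hconv : ∀ t ∈ Set.Icc T₀ T, 3 * E - g (f t) ≤ f'' t) :
    ∀ t ∈ Set.Icc T₀ T, f T₀ + E * (t - T₀) ^ 2 ≤ f t := by
  have hT₀ : T₀ ∈ Set.Icc T₀ T := Set.left_mem_Icc.2 hTT.le
  have hconvex : ∀ t ∈ Set.Icc T₀ T, f T₀ ≤ f t → 2 * E ≤ f'' t := fun t ht hle => by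
    linarith [hconv t ht, hg hle]
  have hpos' := deriv_pos_of_deriv_two_nonneg_of_le hf hf' hpos fun t ht hle => by
    linarith [hconvex t ht hle]
  have hmono : MonotoneOn f (Set.Icc T₀ T) :=
    monotoneOn_Icc_of_hasDerivWithinAt_nonneg le_rfl hf fun t ht =>
      (hpos' t (Set.Ioo_subset_Icc_self ht)).le
  have hmono' : MonotoneOn (fun t => f' t - 2 * E * (t - T₀)) (Set.Icc T₀ T) := by
    refine monotoneOn_Icc_of_hasDerivWithinAt_nonneg (f' := fun t => f'' t - 2 * E * 1) le_rfl
      (fun t ht => (hf' t ht).sub (((hasDerivWithinAt_id t _).sub_const T₀).const_mul (2 * E)))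
      fun t ht => ?_
    have ht' := Set.Ioo_subset_Icc_self ht
    linarith [hconvex t ht' (hmono hT₀ ht' ht'.1)]
  have hquad : MonotoneOn (fun t => f t - E * (t - T₀) ^ 2) (Set.Icc T₀ T) := by
    refine monotoneOn_Icc_of_hasDerivWithinAt_nonneg
      (f' := fun t => f' t - E * (((2 : ℕ) : ℝ) * (t - T₀) ^ (2 - 1) * 1)) le_rfl
      (fun t ht => (hf t ht).sub
        ((((hasDerivWithinAt_id t _).sub_const T₀).pow 2).const_mul E))
      fun t ht => ?_
    have ht' := Set.Ioo_subset_Icc_self ht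
    have h := hmono' hT₀ ht' ht'.1
    norm_num at h ⊢
    linarith
  intro t ht
  have h := hquad hT₀ ht ht.1
  norm_num at h
  linarith
end

section
/- Under Assumption A, for each fixed t ∈ ℝ and each (x,ξ) ∈ ℝ^{2n}, the Hamilton flow of p^λ converges to the Hamilton flow of the kinetic energy k as λ → ∞: lim_{λ→∞} exp(tH_{p^λ})(x,ξ) = exp(tH_k)(x,ξ). -/
open Real Filter
open scoped BigOperators Topology

/-- Continuous dependence of ODE solutions on a perturbation of the vector field, for forward
times: solutions of `z' = f z + ε g z` converge to the solution of `z' = f z` as `ε → 0`. -/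
theorem tendsto_of_hasDerivAt_add_smul_of_nonneg {ι E : Type*} [NormedAddCommGroup E]
    [NormedSpace ℝ E] [ProperSpace E] {l : Filter ι} {f g : E → E} (hf : LocallyLipschitz f)
    (hg : Continuous g) {z₀ : ℝ → E} (hz₀ : ∀ t, HasDerivAt z₀ (f (z₀ t)) t)
    {ε : ι → ℝ} (hε : Tendsto ε l (𝓝 0)) {z : ι → ℝ → E}
    (hz : ∀ᶠ i in l, (∀ t, HasDerivAt (z i) (f (z i t) + ε i • g (z i t)) t) ∧ z i 0 = z₀ 0)
    {T : ℝ} (hT : 0 ≤ T) : Tendsto (fun i => z i T) l (𝓝 (z₀ T)) := by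
  have hz₀c : Continuous z₀ := continuous_iff_continuousAt.2 fun t => (hz₀ t).continuousAt
  obtain ⟨R, hR⟩ := (isCompact_Icc (a := 0) (b := T)).exists_bound_of_continuousOn
    hz₀c.continuousOn
  have hB : IsCompact (Metric.closedBall (0 : E) (R + 1)) := isCompact_closedBall _ _
  obtain ⟨K, hK⟩ := (hf.locallyLipschitzOn (s := Metric.closedBall (0 : E) (R + 1))
    ).exists_lipschitzOnWith_of_compact hB
  obtain ⟨M, hM⟩ := hB.exists_bound_of_continuousOn hg.continuousOn
  rw [Metric.tendsto_nhds]
  intro r hr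
  set c : ℝ := (K : ℝ) + 1
  have hc : 0 < c := by positivity
  set δ : ℝ := min 1 (r / 2) * Real.exp (-(c * T)) with hδ
  have hδ0 : 0 < δ := by positivity
  have hle : ∀ t ∈ Set.Icc 0 T, δ * Real.exp (c * t) ≤ min 1 (r / 2) := by
    intro t ht
    rw [hδ, mul_assoc, ← Real.exp_add]
    refine mul_le_of_le_one_right (by positivity) (Real.exp_le_one_iff.2 ?_)
    nlinarith [ht.2]
  have hsmall : ∀ᶠ i in l, |ε i| * M < δ := by
    have h : Tendsto (fun i => |ε i| * M) l (𝓝 0) := by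
      simpa using (hε.abs).mul_const M
    exact h.eventually_lt_const hδ0
  filter_upwards [hsmall, hz] with i hi hzi
  have hd : ∀ t, HasDerivAt (fun s => z i s - z₀ s)
      (f (z i t) + ε i • g (z i t) - f (z₀ t)) t := fun t => (hzi.1 t).sub (hz₀ t)
  have key : ∀ ⦃t⦄, t ∈ Set.Icc 0 T → ‖z i t - z₀ t‖ ≤ δ * Real.exp (c * t) := by
    refine image_norm_le_of_norm_deriv_right_lt_deriv_boundary
      (f := fun s => z i s - z₀ s) (B := fun t => δ * Real.exp (c * t))
      (B' := fun t => δ * (Real.exp (c * t) * c))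
      (fun t _ => (hd t).continuousAt.continuousWithinAt)
      (fun t _ => (hd t).hasDerivWithinAt) ?_ ?_ ?_
    · simpa [hzi.2] using hδ0.le
    · intro t
      have := ((hasDerivAt_id t).const_mul c).exp.const_mul δ
      simpa using this
    · intro t ht heq
      have htI : t ∈ Set.Icc 0 T := ⟨ht.1, ht.2.le⟩
      have h1 : ‖z i t - z₀ t‖ ≤ 1 := by
        rw [heq]; exact (hle t htI).trans (min_le_left _ _)
      have hm₀ : z₀ t ∈ Metric.closedBall (0 : E) (R + 1) := by
        rw [mem_closedBall_zero_iff]; linarith [hR t htI]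
      have hm : z i t ∈ Metric.closedBall (0 : E) (R + 1) := by
        rw [mem_closedBall_zero_iff]
        have := norm_le_norm_add_norm_sub' (z i t) (z₀ t)
        linarith [hR t htI]
      have hL := hK.norm_sub_le hm hm₀
      have hexp : 1 ≤ Real.exp (c * t) := Real.one_le_exp (mul_nonneg hc.le ht.1)
      have hG : ‖ε i • g (z i t)‖ < δ := by
        rw [norm_smul, Real.norm_eq_abs]
        exact (mul_le_mul_of_nonneg_left (hM _ hm) (abs_nonneg _)).trans_lt hi
      calc ‖f (z i t) + ε i • g (z i t) - f (z₀ t)‖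
          = ‖(f (z i t) - f (z₀ t)) + ε i • g (z i t)‖ := by congr 1; abel
        _ ≤ ‖f (z i t) - f (z₀ t)‖ + ‖ε i • g (z i t)‖ := norm_add_le _ _
        _ < K * (δ * Real.exp (c * t)) + δ := by rw [← heq]; linarith
        _ ≤ δ * (Real.exp (c * t) * c) := by
          have : δ * 1 ≤ δ * Real.exp (c * t) := mul_le_mul_of_nonneg_left hexp hδ0.le
          simp only [c]
          simp only [c] at this
          linarith
  have hTm : T ∈ Set.Icc 0 T := ⟨hT, le_rfl⟩
  rw [dist_eq_norm]
  have h2 := (key hTm).trans ((hle T hTm).trans (min_le_right _ _))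
  linarith

/-- Continuous dependence of ODE solutions on a perturbation of the vector field: solutions of
`z' = f z + ε g z` converge to the solution of `z' = f z` as `ε → 0`. -/
theorem tendsto_of_hasDerivAt_add_smul {ι E : Type*} [NormedAddCommGroup E]
    [NormedSpace ℝ E] [ProperSpace E] {l : Filter ι} {f g : E → E} (hf : LocallyLipschitz f)
    (hg : Continuous g) {z₀ : ℝ → E} (hz₀ : ∀ t, HasDerivAt z₀ (f (z₀ t)) t)
    {ε : ι → ℝ} (hε : Tendsto ε l (𝓝 0)) {z : ι → ℝ → E}
    (hz : ∀ᶠ i in l, (∀ t, HasDerivAt (z i) (f (z i t) + ε i • g (z i t)) t) ∧ z i 0 = z₀ 0)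
    (T : ℝ) : Tendsto (fun i => z i T) l (𝓝 (z₀ T)) := by
  rcases le_total 0 T with hT | hT
  · exact tendsto_of_hasDerivAt_add_smul_of_nonneg hf hg hz₀ hε hz hT
  · have hneg : ∀ {w : ℝ → E} {w' : E} {t : ℝ}, HasDerivAt w w' (-t) →
        HasDerivAt (fun s => w (-s)) (-w') t := fun {w w' t} h => by
      simpa [Function.comp_def] using HasDerivAt.scomp t h (hasDerivAt_neg t)
    have := tendsto_of_hasDerivAt_add_smul_of_nonneg (T := -T) (f := fun x => -f x)
      (g := fun x => -g x) (z₀ := fun s => z₀ (-s)) (z := fun i s => z i (-s)) (l := l) (ε := ε)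
      (LipschitzWith.id.neg.locallyLipschitz.comp hf) hg.neg (fun t => hneg (hz₀ (-t))) hε
      (hz.mono fun i hi => ⟨fun t => by
        have := hneg (hi.1 (-t))
        rwa [neg_add, ← smul_neg] at this, by simpa using hi.2⟩) (by linarith)
    simpa using this

/-- A curve in Euclidean space is differentiable when its coordinates are. -/
theorem hasDerivAt_toLp_of_forall {n : ℕ} {y : ℝ → En n} {y' : Fin n → ℝ} {t : ℝ}
    (h : ∀ j, HasDerivAt (fun s => y s j) (y' j) t) :
    HasDerivAt y (WithLp.toLp 2 y') t := by
  exact (PiLp.continuousLinearEquiv 2 ℝ fun _ : Fin n => ℝ).symm.hasFDerivAt.comp_hasDerivAt t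
    (hasDerivAt_pi.2 h)

/-- Hamilton vector field of the kinetic energy `ksym a`. -/
noncomputable def kineticField {n : ℕ} (a : Fin n → Fin n → En n → ℝ) (z : En n × En n) : En n × En n :=
  (WithLp.toLp 2 fun j => ∑ i, a j i z.1 * z.2 i,
   WithLp.toLp 2 fun j => -((1 / 2) * ∑ i, ∑ l, pd (a i l) j z.1 * z.2 i * z.2 l))

/-- Hamilton vector field of the potential energy `‖x‖ ^ 2 / 2 + V x`. -/
noncomputable def potentialField {n : ℕ} (V : En n → ℝ) (z : En n × En n) : En n × En n :=
  (0, WithLp.toLp 2 fun j => -(z.1 j + pd V j z.1))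

theorem contDiff_pd {n : ℕ} {f : En n → ℝ} (hf : ContDiff ℝ (⊤ : ℕ∞) f) (j : Fin n) :
    ContDiff ℝ 1 (pd f j) := by
  unfold pd
  exact (hf.fderiv_right (m := 1) (by norm_cast)).clm_apply contDiff_const

theorem contDiff_kineticField {n : ℕ} {a : Fin n → Fin n → En n → ℝ}
    (ha : ∀ j k, ContDiff ℝ (⊤ : ℕ∞) (a j k)) : ContDiff ℝ 1 (kineticField a) := by
  have hcoord : ∀ i : Fin n, ContDiff ℝ 1 fun z : En n × En n => z.2 i := fun i =>
    contDiff_euclidean.1 contDiff_snd i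
  refine ContDiff.prodMk (contDiff_euclidean.2 fun j => ?_) (contDiff_euclidean.2 fun j => ?_)
  · change ContDiff ℝ 1 fun z : En n × En n => ∑ i, a j i z.1 * z.2 i
    refine ContDiff.sum fun i _ => ContDiff.mul ?_ (hcoord i)
    exact ((ha j i).of_le (by norm_cast)).comp contDiff_fst
  · change ContDiff ℝ 1 fun z : En n × En n =>
      -((1 / 2) * ∑ i, ∑ l, pd (a i l) j z.1 * z.2 i * z.2 l)
    refine (contDiff_const.mul (ContDiff.sum fun i _ => ContDiff.sum fun k _ => ?_)).neg
    exact (((contDiff_pd (ha i k) j).comp contDiff_fst).mul (hcoord i)).mul (hcoord k)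

theorem continuous_potentialField {n : ℕ} {V : En n → ℝ} (hV : ContDiff ℝ (⊤ : ℕ∞) V) :
    Continuous (potentialField V) := by
  refine continuous_const.prodMk ((PiLp.continuous_toLp 2 _).comp (continuous_pi fun j => ?_))
  have h1 : Continuous fun z : En n × En n => z.1 j := by fun_prop
  exact (h1.add ((contDiff_pd hV j).continuous.comp continuous_fst)).neg

theorem IsFlowK.hasDerivAt {n : ℕ} {a : Fin n → Fin n → En n → ℝ} {y η : ℝ → En n}
    (h : IsFlowK a y η) (t : ℝ) :
    HasDerivAt (fun s => (y s, η s)) (kineticField a (y t, η t)) t :=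
  (hasDerivAt_toLp_of_forall (h.1 t)).prodMk (hasDerivAt_toLp_of_forall (h.2 t))

theorem IsFlowPlam.hasDerivAt {n : ℕ} {a : Fin n → Fin n → En n → ℝ} {V : En n → ℝ} {lam : ℝ}
    {y η : ℝ → En n} (h : IsFlowPlam a V lam y η) (t : ℝ) :
    HasDerivAt (fun s => (y s, η s))
      (kineticField a (y t, η t) + (lam ^ 2)⁻¹ • potentialField V (y t, η t)) t := by
  convert (hasDerivAt_toLp_of_forall (h.1 t)).prodMk (hasDerivAt_toLp_of_forall (h.2 t)) using 1
  refine Prod.ext ?_ ?_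
  · simp [kineticField, potentialField]
  · ext j
    simp [kineticField, potentialField]
    ring

/-- formula (2.3). Under Assumption A, for each fixed `t` and `(x,ξ)`,
the Hamilton flow of `p^λ` converges to the Hamilton flow of `k` as `λ → ∞`:
`lim_{λ→∞} exp(tH_{p^λ})(x,ξ) = exp(tH_k)(x,ξ)`. -/
theorem stmt_10 {n : ℕ} (a : Fin n → Fin n → En n → ℝ) (V : En n → ℝ) (μ : ℝ)
    (hA : AssumptionA n a V μ) (x ξ : En n)
    (ty tη : ℝ → En n) (hk : IsFlowK a ty tη) (hty0 : ty 0 = x) (htη0 : tη 0 = ξ)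
    (Y H : ℝ → ℝ → En n)
    (hYH : ∀ lam : ℝ, 0 < lam →
      IsFlowPlam a V lam (Y lam) (H lam) ∧ Y lam 0 = x ∧ H lam 0 = ξ) :
    ∀ t : ℝ, Filter.Tendsto (fun lam : ℝ => (Y lam t, H lam t)) Filter.atTop
      (nhds (ty t, tη t)) := by
  intro t
  have hε : Tendsto (fun lam : ℝ => (lam ^ 2)⁻¹) atTop (𝓝 0) :=
    (tendsto_pow_atTop two_ne_zero).inv_tendsto_atTop
  refine tendsto_of_hasDerivAt_add_smul (z₀ := fun s => (ty s, tη s))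
    (z := fun lam s => (Y lam s, H lam s)) (contDiff_kineticField hA.smooth_a).locallyLipschitz
    (continuous_potentialField hA.smooth_V) hk.hasDerivAt hε ?_ t
  filter_upwards [eventually_gt_atTop 0] with lam hlam
  obtain ⟨hflow, hY0, hH0⟩ := hYH lam hlam
  exact ⟨hflow.hasDerivAt, by simp only [hY0, hH0, hty0, htη0]⟩
end
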